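/- (Integral form of the Chebyshev coefficients of a shifted Bessel function.) Let k and ℓ be nonnegative integers and let u and v be real numbers. Then (2/π) ∫_0^π J_k( u·cos τ + v ) · cos(ℓτ) dτ = 2 Σ_{q=0}^∞ η_{p(q)} · J_{(p(q)+ℓ)/2}(u/2) · J_{(p(q)−ℓ)/2}(u/2) · [ J_{k−p(q)}(v) + (−1)^{p(q)} J_{k+p(q)}(v) ], where p(q) = 2q when ℓ is even and p(q) = 2q+1 when ℓ is odd, η_0 := 1/2, and η_p := 1 for p ≠ 0; the series on the right converges absolutely. -/

import Mathlib

/-- The Bessel function of the first kind of nonnegative integer order `n`,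
defined by its everywhere-convergent power series. -/
noncomputable def besselJNat (n : ℕ) (x : ℝ) : ℝ :=
  ∑' q : ℕ, (-1 : ℝ) ^ q * (x / 2) ^ (2 * q + n) /
    ((q.factorial : ℝ) * ((q + n).factorial : ℝ))

/-- The Bessel function of the first kind of integer order. -/
noncomputable def besselJ (n : ℤ) (x : ℝ) : ℝ :=
  if 0 ≤ n then besselJNat n.toNat x else (-1 : ℝ) ^ n * besselJNat (-n).toNat x

/-- The `q`-th term of the series giving the Chebyshev coefficients of the shifted
Bessel function, with `p(q) = 2q` for even `ℓ` and `p(q) = 2q + 1` for odd `ℓ`. -/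
noncomputable def neumannTerm (k ℓ : ℕ) (u v : ℝ) (q : ℕ) : ℝ :=
  (if (if Even ℓ then 2 * q else 2 * q + 1) = 0 then (1 : ℝ) / 2 else 1) *
    besselJ ((((if Even ℓ then 2 * q else 2 * q + 1) : ℤ) + (ℓ : ℤ)) / 2) (u / 2) *
    besselJ ((((if Even ℓ then 2 * q else 2 * q + 1) : ℤ) - (ℓ : ℤ)) / 2) (u / 2) *
    (besselJ ((k : ℤ) - ((if Even ℓ then 2 * q else 2 * q + 1) : ℤ)) v +
      (-1 : ℝ) ^ (if Even ℓ then 2 * q else 2 * q + 1) *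
        besselJ ((k : ℤ) + ((if Even ℓ then 2 * q else 2 * q + 1) : ℤ)) v)

open Complex in
lemma bes_summable (n : ℕ) (x : ℝ) : Summable (fun q : ℕ => (-1 : ℝ) ^ q * (x / 2) ^ (2 * q + n) /
    ((q.factorial : ℝ) * ((q + n).factorial : ℝ))) := by
  have h := (Real.summable_pow_div_factorial ((x/2)^2)).mul_left (|x/2|^n)
  refine Summable.of_norm_bounded h (fun q => ?_)
  rw [Real.norm_eq_abs, abs_div, abs_mul, abs_pow, abs_pow, abs_neg, abs_one, one_pow, one_mul,
    abs_of_nonneg (by positivity : (0:ℝ) ≤ (q.factorial : ℝ) * ((q + n).factorial : ℝ))]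
  have e : |x/2|^(2*q+n) = |x/2|^n * ((x/2)^2)^q := by
    rw [pow_add, pow_mul, sq_abs, mul_comm]
  rw [e, ← mul_div_assoc]
  gcongr
  have : (1:ℝ) ≤ ((q + n).factorial : ℝ) := by exact_mod_cast Nat.one_le_iff_ne_zero.mpr (Nat.factorial_ne_zero _)
  have h2 : (0:ℝ) ≤ (q.factorial : ℝ) := by positivity
  nlinarith

def besEquiv : ℤ × ℕ ≃ ℕ × ℕ where
  toFun p := (p.2 + p.1.toNat, p.2 + (-p.1).toNat)
  invFun p := ((p.1 : ℤ) - p.2, min p.1 p.2)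
  left_inv := by
    rintro ⟨n, q⟩
    simp only [Prod.mk.injEq]
    omega
  right_inv := by
    rintro ⟨a, b⟩
    simp only [Prod.mk.injEq]
    omega

lemma besselJ_hasSum (n : ℤ) (x : ℝ) : HasSum (fun q : ℕ => (x / 2) ^ (q + n.toNat) / ((q + n.toNat).factorial : ℝ) *
    ((-(x / 2)) ^ (q + (-n).toNat) / ((q + (-n).toNat).factorial : ℝ))) (besselJ n x) := by
  unfold besselJ
  split_ifs with h
  · have h0 : (-n).toNat = 0 := by omega
    rw [h0]
    convert! (bes_summable n.toNat x).hasSum using 2 with q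
    rw [neg_pow, add_zero]
    field_simp
    ring
  · have h0 : n.toNat = 0 := by omega
    obtain ⟨m, rfl⟩ : ∃ m : ℕ, n = -(m : ℤ) := ⟨(-n).toNat, by omega⟩
    rw [h0]
    convert! ((bes_summable (- -(m:ℤ)).toNat x).hasSum.mul_left ((-1 : ℝ) ^ (-(m:ℤ)))) using 2 with q
    have : ((-1 : ℝ) ^ (-(m:ℤ))) = (-1) ^ m := by
      rw [zpow_neg, zpow_natCast, ← inv_pow]; norm_num
    rw [this, neg_neg, Int.toNat_natCast, neg_pow, add_zero]
    field_simp
    ring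

lemma hasSum_mul_prod {ι κ : Type} {f : ι → ℂ} {g : κ → ℂ} {a b : ℂ} (hf : HasSum f a) (hg : HasSum g b) :
    HasSum (fun i : ι × κ => f i.1 * g i.2) (a * b) :=
  hf.mul hg (summable_mul_of_summable_norm hf.summable.norm hg.summable.norm)

lemma bes_gen (x : ℝ) (z : ℂ) (hz : z ≠ 0) :
    HasSum (fun n : ℤ => (besselJ n x : ℂ) * z ^ n) (Complex.exp ((x / 2) * (z - z⁻¹))) := by
  have e1 : ∀ y : ℂ, HasSum (fun n : ℕ => y ^ n / (n.factorial : ℂ)) (Complex.exp y) := by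
    intro y
    rw [Complex.exp_eq_exp_ℂ]
    exact NormedSpace.expSeries_div_hasSum_exp y
  have h1 := e1 ((x / 2) * z)
  have h2 := e1 (-(x / 2) * z⁻¹)
  have h3 := hasSum_mul_prod h1 h2
  rw [← Complex.exp_add] at h3
  have h4 := besEquiv.hasSum_iff.mpr h3
  have h5 := HasSum.prod_fiberwise (g := fun n : ℤ => (besselJ n x : ℂ) * z ^ n) h4 ?_
  · convert! h5 using 2
    ring
  · intro n
    have h6 := (Complex.hasSum_ofReal.mpr (besselJ_hasSum n x)).mul_right (z ^ n)
    convert! h6 using 2 with q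
    simp only [besEquiv, Function.comp, Equiv.coe_fn_mk]
    have hzn : z ^ n = z ^ (q + n.toNat) * z⁻¹ ^ (q + (-n).toNat) := by
      rw [inv_pow, ← zpow_natCast, ← zpow_natCast, ← zpow_neg, ← zpow_add₀ hz]
      congr 1
      push_cast
      omega
    rw [hzn, mul_pow, mul_pow]
    push_cast
    ring

lemma bes_norm_summable (x : ℝ) : Summable (fun n : ℤ => ‖(besselJ n x : ℂ)‖) := by
  have := (bes_gen x 1 one_ne_zero).summable.norm
  simpa using this

lemma bes_gen_exp (x θ : ℝ) :
    HasSum (fun n : ℤ => (besselJ n x : ℂ) * Complex.exp (n * (θ * Complex.I)))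
      (Complex.exp (x * (Real.sin θ) * Complex.I)) := by
  convert! bes_gen x (Complex.exp (θ * Complex.I)) (Complex.exp_ne_zero _) using 2 with n
  · rw [← Complex.exp_int_mul]
  · rw [← Complex.exp_neg, Complex.ofReal_sin, Complex.sin, neg_mul]
    ring_nf
    simp
    ring

lemma exp_int_integral (n : ℤ) : ∫ θ in (0:ℝ)..(2 * Real.pi), Complex.exp (n * (θ * Complex.I)) =
    if n = 0 then 2 * (Real.pi : ℂ) else 0 := by
  split_ifs with h
  · subst h; simp
  · have hc : (n : ℂ) * Complex.I ≠ 0 := by simp [h]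
    have := integral_exp_mul_complex (a := 0) (b := 2 * Real.pi) hc
    calc _ = ∫ θ in (0:ℝ)..(2 * Real.pi), Complex.exp (n * Complex.I * θ) := by
          congr 1; ext θ; congr 1; ring
      _ = _ := by
        rw [this]
        have : Complex.exp (n * Complex.I * (2 * Real.pi : ℝ)) = 1 := by
          rw [← Complex.exp_int_mul_two_pi_mul_I n]; congr 1; push_cast; ring
        rw [this]; simp

lemma cos_int_integral (n : ℤ) : ∫ θ in (0:ℝ)..Real.pi, Real.cos (n * θ) =
    if n = 0 then Real.pi else 0 := by
  split_ifs with h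
  · subst h; simp
  · have hc : (n : ℝ) ≠ 0 := by simp [h]
    rw [intervalIntegral.integral_comp_mul_left _ hc]
    simp [Real.sin_int_mul_pi]

lemma coscos_integral (m l : ℤ) : ∫ θ in (0:ℝ)..Real.pi, Real.cos (m * θ) * Real.cos (l * θ) =
    Real.pi / 2 * ((if m = l then 1 else 0) + (if m = -l then 1 else 0)) := by
  calc _ = ∫ θ in (0:ℝ)..Real.pi, (1/2) * (Real.cos ((m - l : ℤ) * θ) + Real.cos ((m + l : ℤ) * θ)) := by
        congr 1; ext θ; push_cast; rw [sub_mul, add_mul, Real.cos_sub, Real.cos_add]; ring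
    _ = _ := by
      rw [intervalIntegral.integral_const_mul, intervalIntegral.integral_add
        (Continuous.intervalIntegrable (by fun_prop) _ _) (Continuous.intervalIntegrable (by fun_prop) _ _),
        cos_int_integral, cos_int_integral]
      simp only [sub_eq_zero, add_eq_zero_iff_eq_neg]
      split_ifs <;> ring

lemma fourier_extract {ι : Type} [Countable ι] (c : ι → ℂ) (m : ι → ℤ) (F : ℝ → ℂ) (k : ℤ)
    (hc : Summable (fun i => ‖c i‖))
    (hF : ∀ θ : ℝ, HasSum (fun i => c i * Complex.exp (m i * (θ * Complex.I))) (F θ)) :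
    HasSum (fun i => c i * (if m i = k then 2 * (Real.pi : ℂ) else 0))
      (∫ θ in (0:ℝ)..(2 * Real.pi), F θ * Complex.exp (-k * (θ * Complex.I))) := by
  have := intervalIntegral.hasSum_integral_of_dominated_convergence (μ := MeasureTheory.volume)
    (a := 0) (b := 2 * Real.pi)
    (F := fun i (θ : ℝ) => c i * Complex.exp ((m i - k : ℤ) * (θ * Complex.I)))
    (f := fun θ : ℝ => F θ * Complex.exp (-k * (θ * Complex.I)))
    (fun i _ => ‖c i‖)
    (fun i => Continuous.aestronglyMeasurable (by fun_prop)) ?_ ?_ ?_ ?_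
  · convert! this using 2 with i
    rw [intervalIntegral.integral_const_mul, exp_int_integral]
    simp only [sub_eq_zero]
  · intro i
    refine Filter.Eventually.of_forall fun θ _ => ?_
    rw [norm_mul]
    have : ((m i - k : ℤ) : ℂ) * (θ * Complex.I) = ((m i - k : ℤ) * θ : ℝ) * Complex.I := by
      push_cast; ring
    rw [this, Complex.norm_exp_ofReal_mul_I, mul_one]
  · exact Filter.Eventually.of_forall fun θ _ => hc
  · simp
  · refine Filter.Eventually.of_forall fun θ _ => ?_
    convert! (hF θ).mul_right (Complex.exp (-k * (θ * Complex.I))) using 2 with i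
    rw [mul_assoc, ← Complex.exp_add]
    congr 2; push_cast; ring

/-- Triple product coefficient. -/
noncomputable def besT (k : ℤ) (u v : ℝ) (i : ℤ × ℤ) : ℝ :=
  besselJ i.1 (u / 2) * besselJ i.2 (u / 2) * besselJ (k - i.1 - i.2) v

lemma besT_hasSum (k : ℤ) (u v τ : ℝ) :
    HasSum (fun i : ℤ × ℤ => (besT k u v i : ℂ) * Complex.exp ((i.1 - i.2 : ℤ) * (τ * Complex.I)))
      (besselJ k (u * Real.cos τ + v)) := by
  have s1 := bes_norm_summable (u / 2)
  have s3 := bes_norm_summable v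
  have s12 := s1.mul_norm s1
  have s123 := s12.mul_norm s3
  let c : (ℤ × ℤ) × ℤ → ℂ := fun i => (besselJ i.1.1 (u / 2) : ℂ) * (besselJ i.1.2 (u / 2) : ℂ) *
    (besselJ i.2 v : ℂ) * Complex.exp ((i.1.1 - i.1.2 : ℤ) * (τ * Complex.I))
  have hc : Summable fun i => ‖c i‖ := by
    refine s123.congr fun i => ?_
    have : ((i.1.1 - i.1.2 : ℤ) : ℂ) * (τ * Complex.I) = ((i.1.1 - i.1.2 : ℤ) * τ : ℝ) * Complex.I := by
      push_cast; ring
    simp only [c]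
    rw [this, norm_mul _ (Complex.exp _), Complex.norm_exp_ofReal_mul_I, mul_one]
  have hF : ∀ θ : ℝ, HasSum (fun i => c i * Complex.exp ((i.1.1 + i.1.2 + i.2 : ℤ) * (θ * Complex.I)))
      (Complex.exp ((u * Real.cos τ + v : ℝ) * (Real.sin θ) * Complex.I)) := by
    intro θ
    have g1 := bes_gen_exp (u / 2) (θ + τ)
    have g2 := bes_gen_exp (u / 2) (θ - τ)
    have g3 := bes_gen_exp v θ
    have g12 := hasSum_mul_prod g1 g2
    have g := hasSum_mul_prod g12 g3
    rw [← Complex.exp_add, ← Complex.exp_add] at g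
    convert! g using 2 with i
    · simp only [c]
      rw [mul_assoc, ← Complex.exp_add]
      have : ∀ a b c x y z : ℂ, a * Complex.exp x * (b * Complex.exp y) * (c * Complex.exp z) =
          a * b * c * Complex.exp (x + y + z) := by
        intros; rw [Complex.exp_add, Complex.exp_add]; ring
      rw [this]
      congr 2
      push_cast
      ring
    · rw [Real.sin_add, Real.sin_sub]
      push_cast
      ring
  have A := fourier_extract c (fun i => i.1.1 + i.1.2 + i.2) _ k hc hF
  have B := fourier_extract (fun n : ℤ => (besselJ n (u * Real.cos τ + v) : ℂ)) (fun n => n) _ k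
    (bes_norm_summable _) (bes_gen_exp _)
  have B' : HasSum (fun n : ℤ => (besselJ n (u * Real.cos τ + v) : ℂ) *
      (if n = k then 2 * (Real.pi : ℂ) else 0)) ((besselJ k (u * Real.cos τ + v) : ℂ) * (2 * Real.pi)) := by
    convert! hasSum_ite_eq k ((besselJ k (u * Real.cos τ + v) : ℂ) * (2 * Real.pi)) using 2 with n
    split_ifs with h
    · rw [h]
    · simp
  rw [B.unique B'] at A
  have hg : Function.Injective (fun i : ℤ × ℤ => (i, k - i.1 - i.2)) := by
    intro i j h
    exact (Prod.mk.inj h).1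
  have A2 := (hg.hasSum_iff ?_).mpr A
  · have hp : (2 * (Real.pi : ℂ)) ≠ 0 := by simp [Real.pi_ne_zero]
    have A3 := A2.mul_right (2 * (Real.pi : ℂ))⁻¹
    rw [mul_inv_cancel_right₀ hp] at A3
    convert! A3 using 2 with i
    simp only [Function.comp, c, besT]
    rw [if_pos (by ring), mul_inv_cancel_right₀ hp]
    push_cast
    ring
  · rintro ⟨i, m⟩ hi
    rw [if_neg, mul_zero]
    intro h
    apply hi
    refine ⟨i, ?_⟩
    simp only [Prod.mk.injEq, true_and]
    simp only at h
    omega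

lemma besT_hasSum_cos (k : ℤ) (u v τ : ℝ) :
    HasSum (fun i : ℤ × ℤ => besT k u v i * Real.cos ((i.1 - i.2 : ℤ) * τ))
      (besselJ k (u * Real.cos τ + v)) := by
  have h := Complex.hasSum_re (besT_hasSum k u v τ)
  rw [Complex.ofReal_re] at h
  convert! h using 2 with i
  rw [Complex.re_ofReal_mul]
  have : ((i.1 - i.2 : ℤ) : ℂ) * (τ * Complex.I) = ((i.1 - i.2 : ℤ) * τ : ℝ) * Complex.I := by
    push_cast; ring
  rw [this, Complex.exp_ofReal_mul_I_re]

lemma besT_summable (k : ℤ) (u v : ℝ) : Summable (besT k u v) := by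
  have := (besT_hasSum_cos k u v 0).summable
  simpa using this

lemma bes_integral (k : ℤ) (ℓ : ℕ) (u v : ℝ) :
    HasSum (fun b : ℤ => besselJ (b + ℓ) (u / 2) * besselJ b (u / 2) * besselJ (k - 2 * b - ℓ) v)
      (1 / Real.pi * ∫ τ in (0 : ℝ)..Real.pi, besselJ k (u * Real.cos τ + v) * Real.cos (ℓ * τ)) := by
  have hs := besT_summable k u v
  have A := intervalIntegral.hasSum_integral_of_dominated_convergence (μ := MeasureTheory.volume)
    (a := 0) (b := Real.pi)
    (F := fun i (τ : ℝ) => besT k u v i * (Real.cos ((i.1 - i.2 : ℤ) * τ) * Real.cos ((ℓ : ℤ) * τ)))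
    (f := fun τ : ℝ => besselJ k (u * Real.cos τ + v) * Real.cos (ℓ * τ))
    (fun i _ => |besT k u v i|)
    (fun i => Continuous.aestronglyMeasurable (by fun_prop)) ?_ ?_ ?_ ?_
  · simp only [intervalIntegral.integral_const_mul, coscos_integral] at A
    let f : ℤ → ℝ := fun b => besselJ (b + ℓ) (u / 2) * besselJ b (u / 2) * besselJ (k - 2 * b - ℓ) v
    have i1 : Function.Injective (fun b : ℤ => (b + (ℓ : ℤ), b)) := fun a b h => (Prod.mk.inj h).2
    have i2 : Function.Injective (fun b : ℤ => (b, b + (ℓ : ℤ))) := fun a b h => (Prod.mk.inj h).1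
    have c1 : (besT k u v ∘ fun b : ℤ => (b + (ℓ : ℤ), b)) = f := by
      ext b
      simp only [Function.comp, besT, f]
      congr 2
      ring
    have c2 : (besT k u v ∘ fun b : ℤ => (b, b + (ℓ : ℤ))) = f := by
      ext b
      simp only [Function.comp, besT, f]
      rw [mul_comm (besselJ b _)]
      congr 2
      ring
    have hf : Summable f := c1 ▸ hs.comp_injective i1
    have H1 : HasSum (fun i : ℤ × ℤ => besT k u v i * (if i.1 - i.2 = ℓ then 1 else 0)) (∑' b, f b) := by
      refine (i1.hasSum_iff ?_).mp ?_
      · rintro ⟨a, b⟩ h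
        rw [if_neg, mul_zero]
        intro h'
        exact h ⟨b, by simp only [Prod.mk.injEq, and_true]; simp only at h'; omega⟩
      · convert! hf.hasSum using 1
        rw [← c1]
        ext b
        simp
    have H2 : HasSum (fun i : ℤ × ℤ => besT k u v i * (if i.1 - i.2 = -(ℓ : ℤ) then 1 else 0)) (∑' b, f b) := by
      refine (i2.hasSum_iff ?_).mp ?_
      · rintro ⟨a, b⟩ h
        rw [if_neg, mul_zero]
        intro h'
        exact h ⟨a, by simp only [Prod.mk.injEq, true_and]; simp only at h'; omega⟩
      · convert! hf.hasSum using 1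
        rw [← c2]
        ext b
        simp
    have H := (H1.add H2).mul_left (Real.pi / 2)
    have H' := A.unique (by convert! H using 2 with i; ring)
    rw [H']
    convert! hf.hasSum using 1
    have := Real.pi_ne_zero
    field_simp
    ring
  · intro i
    refine Filter.Eventually.of_forall fun θ _ => ?_
    rw [Real.norm_eq_abs, abs_mul, abs_mul]
    refine mul_le_of_le_one_right (abs_nonneg _) ?_
    exact mul_le_one₀ (Real.abs_cos_le_one _) (abs_nonneg _) (Real.abs_cos_le_one _)
  · exact Filter.Eventually.of_forall fun θ _ => hs.abs
  · simp
  · refine Filter.Eventually.of_forall fun θ _ => ?_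
    convert! (besT_hasSum_cos k u v θ).mul_right (Real.cos (ℓ * θ)) using 2 with i
    push_cast
    ring

lemma besselJ_neg (n : ℤ) (x : ℝ) : besselJ (-n) x = (-1) ^ n * besselJ n x := by
  have hs : ((-1 : ℝ) ^ n) * (-1) ^ n = 1 := by
    rw [← mul_zpow]; simp
  have hi : ((-1 : ℝ) ^ (-n)) = (-1) ^ n := by
    rw [zpow_neg]; exact (eq_inv_of_mul_eq_one_left hs).symm
  unfold besselJ
  rcases lt_trichotomy n 0 with h | h | h
  · rw [if_pos (by omega), if_neg (by omega), ← mul_assoc, hs, one_mul]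
  · subst h; simp
  · rw [if_neg (by omega), if_pos (by omega), neg_neg, hi]

lemma neumann_hasSum (k ℓ : ℕ) (u v : ℝ) : HasSum (neumannTerm k ℓ u v)
    (1 / Real.pi * ∫ τ in (0 : ℝ)..Real.pi, besselJ k (u * Real.cos τ + v) * Real.cos (ℓ * τ)) := by
  have h := bes_integral k ℓ u v
  set S := 1 / Real.pi * ∫ τ in (0 : ℝ)..Real.pi, besselJ k (u * Real.cos τ + v) * Real.cos (ℓ * τ)
  rcases Nat.even_or_odd' ℓ with ⟨r, rfl | rfl⟩
  · have he : Even (2 * r) := even_two_mul r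
    have h2 := (Equiv.subRight (r : ℤ)).hasSum_iff.mpr h
    have h3 := h2.nat_add_neg
    have h4 := h3.sub (hasSum_ite_eq 0 (besselJ r (u / 2) * besselJ (-r) (u / 2) * besselJ k v))
    convert! h4 using 1
    · ext q
      have e1 : ((2 * q : ℤ) + ((2 * r : ℕ) : ℤ)) / 2 = q + r := by push_cast; omega
      have e2 : ((2 * q : ℤ) - ((2 * r : ℕ) : ℤ)) / 2 = q - r := by push_cast; omega
      simp only [neumannTerm, if_pos he, Function.comp, Equiv.subRight_apply, e1, e2]
      have e3 : (q : ℤ) - r + ((2 * r : ℕ) : ℤ) = q + r := by push_cast; ring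
      have e4 : (k : ℤ) - 2 * (q - r) - ((2 * r : ℕ) : ℤ) = k - 2 * q := by push_cast; ring
      have e5 : -(q : ℤ) - r + ((2 * r : ℕ) : ℤ) = -(q - r) := by push_cast; ring
      have e6 : (k : ℤ) - 2 * (-q - r) - ((2 * r : ℕ) : ℤ) = k + 2 * q := by push_cast; ring
      have e7 : -(q : ℤ) - r = -(q + r) := by ring
      rw [e3, e4, e5, e6, e7, besselJ_neg, besselJ_neg (q + r)]
      have hs : ((-1 : ℝ) ^ ((q : ℤ) - r)) * (-1) ^ ((q : ℤ) + r) = 1 := by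
        rw [← zpow_add₀ (by norm_num)]
        exact Even.neg_one_zpow ⟨q, by ring⟩
      have hq : (-1 : ℝ) ^ (2 * q) = 1 := by simp
      rw [hq]
      by_cases q0 : q = 0
      · subst q0
        simp
        have hs' : ((-1 : ℝ) ^ r)⁻¹ * (-1) ^ r = 1 := inv_mul_cancel₀ (by simp)
        linear_combination (-besselJ r (u/2) * besselJ (-r) (u/2) * besselJ k v) * hs'
      · simp only [mul_eq_zero, q0, or_false, OfNat.ofNat_ne_zero, if_false]
        linear_combination (-besselJ (q + r) (u/2) * besselJ (q-r) (u/2) * besselJ (k+2*q) v) * hs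
    · simp
      ring_nf
  · have he : ¬ Even (2 * r + 1) := by simp
    have h2 := (Equiv.subRight (r : ℤ)).hasSum_iff.mpr h
    have h3 := h2.nat_add_neg_add_one
    convert! h3 using 1
    ext q
    have e1 : ((2 * q + 1 : ℤ) + ((2 * r + 1 : ℕ) : ℤ)) / 2 = q + r + 1 := by push_cast; omega
    have e2 : ((2 * q + 1 : ℤ) - ((2 * r + 1 : ℕ) : ℤ)) / 2 = q - r := by push_cast; omega
    simp only [neumannTerm, if_neg he, Function.comp, Equiv.subRight_apply, e1, e2]
    have e3 : (q : ℤ) - r + ((2 * r + 1 : ℕ) : ℤ) = q + r + 1 := by push_cast; ring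
    have e4 : (k : ℤ) - 2 * (q - r) - ((2 * r + 1 : ℕ) : ℤ) = k - (2 * q + 1) := by push_cast; ring
    have e5 : -((q : ℤ) + 1) - r + ((2 * r + 1 : ℕ) : ℤ) = -(q - r) := by push_cast; ring
    have e6 : (k : ℤ) - 2 * (-(q + 1) - r) - ((2 * r + 1 : ℕ) : ℤ) = k + (2 * q + 1) := by push_cast; ring
    have e7 : -((q : ℤ) + 1) - r = -(q + r + 1) := by ring
    rw [e3, e4, e5, e6, e7, besselJ_neg, besselJ_neg (q + r + 1)]
    have hs : ((-1 : ℝ) ^ ((q : ℤ) - r)) * (-1) ^ ((q : ℤ) + r + 1) = -1 := by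
      rw [← zpow_add₀ (by norm_num)]
      exact Odd.neg_one_zpow ⟨q, by ring⟩
    have hq : (-1 : ℝ) ^ (2 * q + 1) = -1 := by simp [pow_succ]
    rw [hq, if_neg (by omega)]
    linear_combination (-besselJ (q + r + 1) (u/2) * besselJ (q-r) (u/2) * besselJ (k+(2*q+1)) v) * hs

theorem stmt8 (k ℓ : ℕ) (u v : ℝ) :
    Summable (fun q : ℕ => |neumannTerm k ℓ u v q|) ∧
    2 / Real.pi * ∫ τ in (0 : ℝ)..Real.pi,
        besselJ (k : ℤ) (u * Real.cos τ + v) * Real.cos (ℓ * τ) =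
      2 * ∑' q : ℕ, neumannTerm k ℓ u v q := by
  have h := neumann_hasSum k ℓ u v
  refine ⟨h.summable.abs, ?_⟩
  rw [h.tsum_eq]
  ring
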